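/- Let p ≥ 1 be an integer and let i, j, n be natural numbers with j ≤ pi and i ≤ n. Then the number of lattice paths from (i,j) to (n, pn) with unit up steps (0,1) and unit right steps (1,0) in which every point (a,b) on the path satisfies b ≤ pa equals the number of lattice paths from (1,0) to (pn−j+1, n−i) with unit up steps (0,1) and unit right steps (1,0) in which every point (a,b) on the path satisfies a > pb. -/

import Mathlib

/-- The number of entries of value `b` among the first `k` entries of `s`. -/
def countUpto {L : ℕ} (s : Fin L → Bool) (k : ℕ) (b : Bool) : ℕ :=
  (Finset.univ.filter fun i : Fin L => i.val < k ∧ s i = b).card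

/-- The number of monotone lattice paths starting at `(a, b)`, consisting of `r` unit right
steps `(1,0)` and `u` unit up steps `(0,1)` in some order (hence ending at `(a + r, b + u)`),
such that every point `(x, y)` visited by the path satisfies `ok x y`.  A path is encoded by
the sequence of its steps: `s i = true` means the `i`-th step is a right step and
`s i = false` means it is an up step. -/
def monoPathCount (a b : ℤ) (r u : ℕ) (ok : ℤ → ℤ → Prop)
    [∀ x y, Decidable (ok x y)] : ℕ :=
  (Finset.univ.filter fun s : Fin (r + u) → Bool =>
    countUpto s (r + u) true = r ∧
    ∀ k, k ≤ r + u →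
      ok (a + (countUpto s k true : ℤ)) (b + (countUpto s k false : ℤ))).card

/-- Reverse a step sequence and exchange right steps with up steps. -/
def reverseSwap {L M : ℕ} (h : L = M) (s : Fin L → Bool) : Fin M → Bool :=
  fun i => !s (Fin.rev (Fin.cast h.symm i))

lemma reverseSwap_reverseSwap {L M : ℕ} (h : L = M) (s : Fin L → Bool) :
    reverseSwap h.symm (reverseSwap h s) = s := by
  subst h
  ext i
  simp [reverseSwap]

lemma countUpto_true_add_false {L : ℕ} (s : Fin L → Bool) :
    countUpto s L true + countUpto s L false = L := by
  have h := Finset.card_filter_add_card_filter_not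
    (s := (Finset.univ : Finset (Fin L))) (fun i => s i = true)
  simpa [countUpto] using h

lemma countUpto_le {L : ℕ} (s : Fin L → Bool) (k : ℕ) (b : Bool) :
    countUpto s k b ≤ countUpto s L b := by
  refine Finset.card_le_card fun i hi => ?_
  simp_all

lemma countUpto_reverseSwap_add {L M : ℕ} (h : L = M) (s : Fin L → Bool) (k : ℕ) (b : Bool)
    (hk : k ≤ L) :
    countUpto (reverseSwap h s) k b + countUpto s (L - k) (!b) = countUpto s L (!b) := by
  subst h
  have hrev : countUpto (reverseSwap rfl s) k b =
      (Finset.univ.filter fun i : Fin L => ¬ i.val < L - k ∧ s i = !b).card := by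
    refine Finset.card_bij' (fun i _ => i.rev) (fun i _ => i.rev) ?_ ?_ ?_ ?_
    · intro i hi
      simp only [Finset.mem_filter, Finset.mem_univ, true_and] at hi ⊢
      simp only [reverseSwap, Fin.cast_eq_self, Fin.val_rev] at hi ⊢
      exact ⟨by omega, by simp [← hi.2]⟩
    · intro i hi
      simp only [Finset.mem_filter, Finset.mem_univ, true_and] at hi ⊢
      simp only [reverseSwap, Fin.cast_eq_self, Fin.val_rev, Fin.rev_rev] at hi ⊢
      exact ⟨by omega, by simp [hi.2]⟩
    · intro i _
      simp
    · intro i _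
      simp
  have hsplit := Finset.card_filter_add_card_filter_not
    (s := Finset.univ.filter fun i : Fin L => s i = !b) (fun i => i.val < L - k)
  simp only [Finset.filter_filter] at hsplit
  rw [hrev, add_comm]
  simpa [countUpto, and_comm] using hsplit

/-- The half-turn of the bounding rectangle followed by a transposition sends admissible paths
to admissible paths. -/
lemma reverseSwap_mem {a b a' b' : ℤ} {r u : ℕ} {ok ok' : ℤ → ℤ → Prop}
    (hok : ∀ x y : ℕ, x ≤ r → y ≤ u →
      ok (a + x) (b + y) → ok' (a' + (u - y)) (b' + (r - x)))
    (s : Fin (r + u) → Bool) (hs : countUpto s (r + u) true = r)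
    (hpath : ∀ k, k ≤ r + u → ok (a + (countUpto s k true : ℤ)) (b + (countUpto s k false : ℤ))) :
    countUpto (reverseSwap (add_comm r u) s) (u + r) true = u ∧
    ∀ k, k ≤ u + r →
      ok' (a' + (countUpto (reverseSwap (add_comm r u) s) k true : ℤ))
        (b' + (countUpto (reverseSwap (add_comm r u) s) k false : ℤ)) := by
  have htotal := countUpto_true_add_false s
  have hcount := fun k => countUpto_reverseSwap_add (add_comm r u) s k
  constructor
  · have h := hcount (u + r) true (by omega)
    have hzero : countUpto s (r + u - (u + r)) false = 0 := by
      simp [countUpto, add_comm]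
    simp only [Bool.not_true] at h
    omega
  · intro k hk
    have ht := hcount k true (by omega)
    have hf := hcount k false (by omega)
    simp only [Bool.not_true, Bool.not_false] at ht hf
    have hx := countUpto_le s (r + u - k) true
    have hy := countUpto_le s (r + u - k) false
    have h := hok _ _ (by omega) (by omega) (hpath (r + u - k) (by omega))
    convert h using 2 <;> omega

lemma monoPathCount_reverse {a b a' b' : ℤ} {r u : ℕ} {ok ok' : ℤ → ℤ → Prop}
    [∀ x y, Decidable (ok x y)] [∀ x y, Decidable (ok' x y)]
    (hok : ∀ x y : ℕ, x ≤ r → y ≤ u →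
      (ok (a + x) (b + y) ↔ ok' (a' + (u - y)) (b' + (r - x)))) :
    monoPathCount a b r u ok = monoPathCount a' b' u r ok' := by
  refine Finset.card_nbij' (reverseSwap (add_comm r u)) (reverseSwap (add_comm u r)) ?_ ?_ ?_ ?_
  · intro s hs
    simp only [Finset.mem_coe, Finset.mem_filter, Finset.mem_univ, true_and] at hs ⊢
    exact reverseSwap_mem (fun x y hx hy => (hok x y hx hy).1) s hs.1 hs.2
  · intro s hs
    simp only [Finset.mem_coe, Finset.mem_filter, Finset.mem_univ, true_and] at hs ⊢
    refine reverseSwap_mem (fun x y hx hy h => ?_) s hs.1 hs.2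
    have h' := hok (r - y) (u - x) (by omega) (by omega)
    push_cast [hx, hy] at h'
    simpa only [sub_sub_cancel] using h'.2 (by simpa only [sub_sub_cancel] using h)
  · intro s _
    exact reverseSwap_reverseSwap _ s
  · intro s _
    exact reverseSwap_reverseSwap _ s

/-- For `p ≥ 1`, `j ≤ pi` and `i ≤ n`, the number of lattice paths from `(i,j)` to
`(n, pn)` all of whose points `(a,b)` satisfy `b ≤ pa` equals the number of lattice paths
from `(1,0)` to `(pn-j+1, n-i)` all of whose points `(a,b)` satisfy `a > pb`. -/
theorem stmt_12 (p : ℕ) (hp : 1 ≤ p) (i j n : ℕ) (hj : j ≤ p * i) (hi : i ≤ n) :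
    monoPathCount (i : ℤ) (j : ℤ) (n - i) (p * n - j) (fun x y => y ≤ (p : ℤ) * x) =
      monoPathCount 1 0 (p * n - j) (n - i) (fun x y => (p : ℤ) * y < x) := by
  have hjn : j ≤ p * n := hj.trans (Nat.mul_le_mul_left p hi)
  refine monoPathCount_reverse fun x y _ _ => ?_
  push_cast [hi, hjn]
  constructor <;> intro h <;> nlinarith
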